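/- For every real ε > 0 there exists a constant C = C(ε) ≥ 1 such that the following holds (Sanders's quasi-polynomial Freiman–Ruzsa theorem). Let G be an additive abelian group in which x + x = 0 for every x ∈ G, let K ≥ 2 be a real number, and let A ⊆ G be a finite nonempty set with |A + A| ≤ K·|A|. Then there exist a finite subgroup H of G with |H| ≤ |A| and a finite set X ⊆ G with |X| ≤ exp(C·(log K)^(4+ε)) such that A ⊆ X + H, i.e. A is covered by at most exp(C·(log K)^(4+ε)) translates of H. -/

import Mathlib

open Pointwise

namespace QuasiPolynomialFreimanRuzsa

open Finset

section Characters

variable {Q : Type*} [AddCommGroup Q]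

/-- The real part of a character. In a group of exponent two this is the character itself. -/
noncomputable def realChar (ψ : AddChar Q ℂ) (x : Q) : ℝ := (ψ x).re

@[simp] lemma realChar_zero (ψ : AddChar Q ℂ) : realChar ψ 0 = 1 := by simp [realChar]

lemma char_eq_one_or_neg_one (h2 : ∀ x : Q, x + x = 0) (ψ : AddChar Q ℂ) (x : Q) :
    ψ x = 1 ∨ ψ x = -1 := by
  rw [← sq_eq_one_iff, sq, ← AddChar.map_add_eq_mul, h2, AddChar.map_zero_eq_one]

lemma ofReal_realChar (h2 : ∀ x : Q, x + x = 0) (ψ : AddChar Q ℂ) (x : Q) :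
    (realChar ψ x : ℂ) = ψ x := by
  rcases char_eq_one_or_neg_one h2 ψ x with h | h <;> simp [realChar, h]

lemma realChar_eq_one_or_neg_one (h2 : ∀ x : Q, x + x = 0) (ψ : AddChar Q ℂ) (x : Q) :
    realChar ψ x = 1 ∨ realChar ψ x = -1 := by
  rcases char_eq_one_or_neg_one h2 ψ x with h | h <;> simp [realChar, h]

lemma abs_realChar (h2 : ∀ x : Q, x + x = 0) (ψ : AddChar Q ℂ) (x : Q) :
    |realChar ψ x| = 1 := by
  rcases realChar_eq_one_or_neg_one h2 ψ x with h | h <;> simp [h]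

lemma realChar_add (h2 : ∀ x : Q, x + x = 0) (ψ : AddChar Q ℂ) (x y : Q) :
    realChar ψ (x + y) = realChar ψ x * realChar ψ y := by
  apply Complex.ofReal_injective
  push_cast
  simp only [ofReal_realChar h2, AddChar.map_add_eq_mul]

lemma realChar_sum (h2 : ∀ x : Q, x + x = 0) (ψ : AddChar Q ℂ) {ι : Type*} (s : Finset ι)
    (t : ι → Q) : realChar ψ (∑ i ∈ s, t i) = ∏ i ∈ s, realChar ψ (t i) := by
  classical
  induction s using Finset.induction_on with
  | empty => simp
  | insert a s ha ih => rw [sum_insert ha, prod_insert ha, realChar_add h2, ih]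

lemma realChar_prod (h2 : ∀ x : Q, x + x = 0) (D : Finset (AddChar Q ℂ)) (x : Q) :
    realChar (∏ ψ ∈ D, ψ) x = ∏ ψ ∈ D, realChar ψ x := by
  apply Complex.ofReal_injective
  push_cast
  simp only [ofReal_realChar h2, AddChar.prod_apply]

lemma add_eq_zero_iff_eq_of_exponent_two (h2 : ∀ x : Q, x + x = 0) {x y : Q} :
    x + y = 0 ↔ x = y := by
  rw [add_eq_zero_iff_eq_neg, neg_eq_of_add_eq_zero_left (h2 y)]

/-- The (unnormalised) Fourier coefficient of the indicator function of `T`. -/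
noncomputable def hat (T : Finset Q) (ψ : AddChar Q ℂ) : ℝ := ∑ t ∈ T, realChar ψ t

lemma abs_hat_le (h2 : ∀ x : Q, x + x = 0) (T : Finset Q) (ψ : AddChar Q ℂ) :
    |hat T ψ| ≤ #T := by
  refine (abs_sum_le_sum_abs _ _).trans ?_
  simp [abs_realChar h2]

variable [Fintype Q]

lemma sum_realChar_apply [DecidableEq Q] (x : Q) :
    ∑ ψ : AddChar Q ℂ, realChar ψ x = if x = 0 then (Fintype.card Q : ℝ) else 0 := by
  have := congrArg Complex.re (AddChar.sum_apply_eq_ite x)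
  rw [Complex.re_sum] at this
  rw [show ∑ ψ : AddChar Q ℂ, realChar ψ x = ∑ ψ : AddChar Q ℂ, (ψ x).re from rfl, this]
  split_ifs <;> simp

lemma sum_realChar_eq_zero {ψ : AddChar Q ℂ} (hψ : ψ ≠ 1) : ∑ x, realChar ψ x = 0 := by
  have := congrArg Complex.re (AddChar.sum_eq_zero_iff_ne_zero.2 hψ)
  rwa [Complex.re_sum] at this

lemma sum_hat_sq (h2 : ∀ x : Q, x + x = 0) (A : Finset Q) :
    ∑ ψ, hat A ψ ^ 2 = Fintype.card Q * #A := by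
  classical
  simp only [hat, sq, sum_mul_sum, ← realChar_add h2]
  rw [sum_comm]
  simp_rw [sum_comm (s := univ) (t := A), sum_realChar_apply,
    add_eq_zero_iff_eq_of_exponent_two h2]
  simp [mul_comm]

/-- A set of characters no nonempty subset of which has trivial product. -/
def Independent (D : Finset (AddChar Q ℂ)) : Prop :=
  ∀ S ⊆ D, S.Nonempty → ∏ ψ ∈ S, ψ ≠ 1

lemma sum_prod_add_mul_realChar (h2 : ∀ x : Q, x + x = 0) {D : Finset (AddChar Q ℂ)}
    (hD : Independent D) (c : ℝ) (b : AddChar Q ℂ → ℝ) :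
    ∑ x, ∏ ψ ∈ D, (c + b ψ * realChar ψ x) = Fintype.card Q * c ^ #D := by
  classical
  simp only [add_comm c, prod_add]
  rw [sum_comm, sum_eq_single ∅]
  · simp
  · intro S hS hne
    simp only [prod_mul_distrib, ← realChar_prod h2]
    rw [← sum_mul, ← mul_sum,
      sum_realChar_eq_zero (hD S (mem_powerset.1 hS) (nonempty_iff_ne_empty.2 hne))]
    simp
  · simp

/-- **Chang's theorem** in exponent two: the large spectrum has small dimension. -/
lemma exp_card_mul_card_le (h2 : ∀ x : Q, x + x = 0) {T : Finset Q} (hT : T.Nonempty)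
    {D : Finset (AddChar Q ℂ)} (hD : Independent D)
    (hDT : ∀ ψ ∈ D, (#T : ℝ) / 2 ≤ |hat T ψ|) :
    Real.exp (#D / 8) * #T ≤ Fintype.card Q := by
  have hT0 : (0 : ℝ) < #T := by exact_mod_cast hT.card_pos
  set s : AddChar Q ℂ → ℝ := fun ψ => SignType.sign (hat T ψ) with hs
  have hs1 : ∀ ψ, |s ψ| ≤ 1 := by
    intro ψ
    rcases lt_trichotomy (hat T ψ) 0 with h | h | h <;> simp [hs, h]
  have hsum : (#D : ℝ) * (#T / 2) ≤ ∑ t ∈ T, ∑ ψ ∈ D, s ψ * realChar ψ t := by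
    rw [sum_comm, ← nsmul_eq_mul, ← sum_const]
    refine sum_le_sum fun ψ hψ => ?_
    rw [← mul_sum]
    exact (hDT ψ hψ).trans_eq (sign_mul_self _).symm
  have hjensen : (#T : ℝ) * Real.exp (#D / 4) ≤
      ∑ t ∈ T, Real.exp (1 / 2 * ∑ ψ ∈ D, s ψ * realChar ψ t) := by
    have key : ∀ t ∈ T, Real.exp (#D / 4) *
        (1 + (1 / 2 * ∑ ψ ∈ D, s ψ * realChar ψ t - #D / 4)) ≤
        Real.exp (1 / 2 * ∑ ψ ∈ D, s ψ * realChar ψ t) := by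
      intro t _
      have h := Real.add_one_le_exp (1 / 2 * ∑ ψ ∈ D, s ψ * realChar ψ t - #D / 4)
      rw [Real.exp_sub, le_div_iff₀ (Real.exp_pos _)] at h
      linarith
    refine le_trans ?_ (sum_le_sum key)
    rw [← mul_sum, sum_add_distrib, sum_sub_distrib, ← mul_sum]
    simp only [sum_const, nsmul_eq_mul, mul_one]
    rw [mul_comm]
    gcongr
    linarith
  have hupper : ∑ t ∈ T, Real.exp (1 / 2 * ∑ ψ ∈ D, s ψ * realChar ψ t) ≤
      Fintype.card Q * Real.exp (#D / 8) := by
    calc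
      _ ≤ ∑ t : Q, Real.exp (1 / 2 * ∑ ψ ∈ D, s ψ * realChar ψ t) :=
        sum_le_sum_of_subset_of_nonneg (subset_univ _) fun _ _ _ => (Real.exp_pos _).le
      _ ≤ ∑ t : Q, ∏ ψ ∈ D,
          (Real.cosh (1 / 2) + (s ψ * Real.sinh (1 / 2)) * realChar ψ t) := by
        refine sum_le_sum fun t _ => ?_
        rw [mul_sum, Real.exp_sum]
        refine prod_le_prod (fun _ _ => (Real.exp_pos _).le) fun ψ _ => ?_
        have : |s ψ * realChar ψ t| ≤ 1 := by
          rw [abs_mul, abs_realChar h2, mul_one]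
          exact hs1 ψ
        have h := Real.exp_mul_le_cosh_add_mul_sinh this (1 / 2)
        calc _ = _ := by rw [mul_comm]
          _ ≤ _ := h
          _ = _ := by ring
      _ = Fintype.card Q * Real.cosh (1 / 2) ^ #D :=
        sum_prod_add_mul_realChar h2 hD _ _
      _ ≤ Fintype.card Q * Real.exp (#D / 8) := by
        gcongr
        calc Real.cosh (1 / 2) ^ #D ≤ Real.exp ((1 / 2) ^ 2 / 2) ^ #D := by
              gcongr
              exact Real.cosh_le_exp_half_sq _
          _ = _ := by rw [← Real.exp_nat_mul]; congr 1; ring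
  have h := hjensen.trans hupper
  have he : Real.exp (#D / 4 : ℝ) = Real.exp (#D / 8) * Real.exp (#D / 8) := by
    rw [← Real.exp_add]; congr 1; ring
  rw [he] at h
  have hp := Real.exp_pos (#D / 8 : ℝ)
  nlinarith

lemma exists_maximal_independent (h2 : ∀ x : Q, x + x = 0) (P : AddChar Q ℂ → Prop) :
    ∃ D : Finset (AddChar Q ℂ), Independent D ∧ (∀ ψ ∈ D, P ψ) ∧
      ∀ φ, P φ → ∀ v, (∀ ψ ∈ D, realChar ψ v = 1) → realChar φ v = 1 := by
  classical
  obtain ⟨D, hD, hmax⟩ := exists_max_image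
    (univ.filter fun D : Finset (AddChar Q ℂ) => Independent D ∧ ∀ ψ ∈ D, P ψ) card
    ⟨∅, by
      simp only [mem_filter, mem_univ, true_and, notMem_empty, false_imp_iff, implies_true,
        and_true]
      intro S hS hne
      simp_all [subset_empty]⟩
  simp only [mem_filter, mem_univ, true_and, and_imp] at hD hmax
  refine ⟨D, hD.1, hD.2, fun φ hφ v hv => ?_⟩
  by_cases hφD : φ ∈ D
  · exact hv φ hφD
  by_cases hind : Independent (insert φ D)
  · have := hmax _ hind (by simpa [hφ] using hD.2)
    rw [card_insert_of_notMem hφD] at this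
    omega
  · simp only [Independent, not_forall] at hind
    obtain ⟨S, hS, hne, hprod⟩ := hind
    push Not at hprod
    have hφS : φ ∈ S := by
      by_contra h
      exact hD.1 S ((subset_insert_iff_of_notMem h).1 hS) hne hprod
    have h := congrArg (fun ψ => realChar ψ v) hprod
    simp only [realChar_prod h2] at h
    rw [← mul_prod_erase _ _ hφS, prod_eq_one, mul_one] at h
    · simpa [realChar] using h
    · intro ψ hψ
      exact hv ψ (by simpa [(mem_erase.1 hψ).1] using hS (mem_of_mem_erase hψ))

/-- The common kernel of a family of characters. -/
def annihilator (h2 : ∀ x : Q, x + x = 0) (D : Finset (AddChar Q ℂ)) : AddSubgroup Q where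
  carrier := {v | ∀ ψ ∈ D, realChar ψ v = 1}
  zero_mem' := by simp
  add_mem' := by
    intro a b ha hb ψ hψ
    rw [realChar_add h2, ha ψ hψ, hb ψ hψ, mul_one]
  neg_mem' := by
    intro a ha
    rwa [neg_eq_of_add_eq_zero_left (h2 a)]

lemma card_le_card_annihilator (h2 : ∀ x : Q, x + x = 0) (D : Finset (AddChar Q ℂ)) :
    Fintype.card Q ≤ Nat.card (annihilator h2 D) * 2 ^ #D := by
  classical
  have hmaps : ∀ x ∈ (univ : Finset Q),
      D.filter (fun ψ => realChar ψ x = 1) ∈ D.powerset := by simp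
  have := card_le_mul_card_image_of_maps_to hmaps (Nat.card (annihilator h2 D)) ?_
  · simpa using this
  intro S _
  have hcard : Nat.card (annihilator h2 D) = #{v : Q | v ∈ annihilator h2 D} := by
    rw [Nat.card_eq_fintype_card, Fintype.card_subtype]
  rw [hcard]
  rcases (filter (fun x => {ψ ∈ D | realChar ψ x = 1} = S) univ).eq_empty_or_nonempty with
    h | ⟨y, hy⟩
  · simp [h]
  refine card_le_card_of_injOn (fun x => x + y) ?_ (add_left_injective y).injOn
  intro x hx
  simp only [coe_filter, mem_univ, true_and, Set.mem_ofPred_eq, mem_filter] at hx hy ⊢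
  intro ψ hψ
  have hiff : realChar ψ x = 1 ↔ realChar ψ y = 1 := by
    have := congrArg (fun s => ψ ∈ s) (hx.trans hy.symm)
    simpa [hψ] using this
  rw [realChar_add h2]
  rcases realChar_eq_one_or_neg_one h2 ψ x with h | h <;>
    rcases realChar_eq_one_or_neg_one h2 ψ y with h' | h' <;> simp_all


/-- The number of ways to land in `S` by adding two elements of `A`, a tuple of elements of `T`,
and `v`. -/
noncomputable def landingCount [DecidableEq Q] (A S T : Finset Q) (ι : Type*) [Fintype ι]
    [DecidableEq ι] (v : Q) : ℝ :=
  ∑ t ∈ Fintype.piFinset (fun _ : ι => T), ∑ a ∈ A, ∑ b ∈ A,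
    if a + b + ∑ i, t i + v ∈ S then 1 else 0

lemma card_mul_indicator [DecidableEq Q] (h2 : ∀ x : Q, x + x = 0) (S : Finset Q) (y : Q) :
    Fintype.card Q * (if y ∈ S then (1 : ℝ) else 0) = ∑ ψ, hat S ψ * realChar ψ y := by
  simp only [hat, sum_mul, ← realChar_add h2]
  rw [sum_comm]
  simp_rw [sum_realChar_apply, add_eq_zero_iff_eq_of_exponent_two h2]
  simp

lemma card_mul_landingCount [DecidableEq Q] (h2 : ∀ x : Q, x + x = 0) (A S T : Finset Q)
    (ι : Type*) [Fintype ι] [DecidableEq ι] (v : Q) :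
    Fintype.card Q * landingCount A S T ι v =
      ∑ ψ, hat S ψ * hat A ψ ^ 2 * hat T ψ ^ Fintype.card ι * realChar ψ v := by
  have hT : ∀ ψ, hat T ψ ^ Fintype.card ι =
      ∑ t ∈ Fintype.piFinset (fun _ : ι => T), realChar ψ (∑ i, t i) := by
    intro ψ
    simp only [realChar_sum h2, hat]
    rw [← prod_univ_sum (fun _ : ι => T) (fun _ x => realChar ψ x)]
    simp
  have hterm : ∀ ψ, hat S ψ * hat A ψ ^ 2 * hat T ψ ^ Fintype.card ι * realChar ψ v =
      ∑ t ∈ Fintype.piFinset (fun _ : ι => T), ∑ a ∈ A, ∑ b ∈ A,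
        hat S ψ * realChar ψ (a + b + ∑ i, t i + v) := by
    intro ψ
    rw [hT, sq, mul_sum, sum_mul]
    refine sum_congr rfl fun t _ => ?_
    rw [show hat A ψ = ∑ a ∈ A, realChar ψ a from rfl, sum_mul_sum, mul_sum, sum_mul, sum_mul]
    refine sum_congr rfl fun a _ => ?_
    rw [mul_sum, sum_mul, sum_mul]
    refine sum_congr rfl fun b _ => ?_
    simp only [realChar_add h2]
    ring
  simp only [landingCount, mul_sum, card_mul_indicator h2, hterm]
  rw [sum_comm (s := univ)]
  refine sum_congr rfl fun t _ => ?_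
  rw [sum_comm (s := univ)]
  refine sum_congr rfl fun a _ => ?_
  rw [sum_comm (s := univ)]

lemma abs_landingCount_sub_le [DecidableEq Q] (h2 : ∀ x : Q, x + x = 0) (A S T : Finset Q)
    (ι : Type*) [Fintype ι] [DecidableEq ι] (v : Q)
    (hv : ∀ ψ, (#T : ℝ) / 2 ≤ |hat T ψ| → realChar ψ v = 1) :
    |landingCount A S T ι v - landingCount A S T ι 0| ≤
      2 * (#T / 2 : ℝ) ^ Fintype.card ι * #S * #A := by
  have hQ : (0 : ℝ) < Fintype.card Q := by
    exact_mod_cast Fintype.card_pos_iff.2 ⟨(0 : Q)⟩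
  refine le_of_mul_le_mul_left ?_ hQ
  rw [← abs_of_pos hQ, ← abs_mul, abs_of_pos hQ, mul_sub, card_mul_landingCount h2,
    card_mul_landingCount h2, ← sum_sub_distrib]
  calc
    _ ≤ ∑ ψ, (2 * (#T / 2 : ℝ) ^ Fintype.card ι * #S) * hat A ψ ^ 2 := by
      refine (abs_sum_le_sum_abs _ _).trans (sum_le_sum fun ψ _ => ?_)
      rw [← mul_sub, realChar_zero]
      by_cases h : (#T : ℝ) / 2 ≤ |hat T ψ|
      · rw [hv ψ h]
        simp only [sub_self, mul_zero, abs_zero]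
        positivity
      · push Not at h
        rw [abs_mul, abs_mul, abs_mul, abs_pow, abs_pow, sq_abs]
        have h1 : |realChar ψ v - 1| ≤ 2 := by
          rcases realChar_eq_one_or_neg_one h2 ψ v with h | h <;> rw [h] <;> norm_num
        calc _ ≤ #S * hat A ψ ^ 2 * (#T / 2 : ℝ) ^ Fintype.card ι * 2 := by
              gcongr
              exact abs_hat_le h2 S ψ
          _ = _ := by ring
    _ = _ := by rw [← mul_sum, sum_hat_sq h2]; ring

end Characters

section Sampling

/-- **Hoeffding's inequality** for sampling with replacement from a finite set. -/
lemma card_filter_lt_sum_le {α : Type*} [DecidableEq α] (A : Finset α) (Y : α → ℝ)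
    (hY : ∀ a ∈ A, |Y a| ≤ 1) (hsum : ∑ a ∈ A, Y a = 0) (k : ℕ) {ε : ℝ} (hε : 0 ≤ ε) :
    (#{t ∈ Fintype.piFinset (fun _ : Fin k => A) | ε * k < ∑ i, Y (t i)} : ℝ) ≤
      #A ^ k * Real.exp (-(ε ^ 2 * k / 2)) := by
  have hexp : ∑ a ∈ A, Real.exp (ε * Y a) ≤ #A * Real.exp (ε ^ 2 / 2) := by
    calc
      _ ≤ ∑ a ∈ A, (Real.cosh ε + Y a * Real.sinh ε) := by
        refine sum_le_sum fun a ha => ?_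
        have := Real.exp_mul_le_cosh_add_mul_sinh (hY a ha) ε
        rwa [mul_comm ε]
      _ = #A * Real.cosh ε := by rw [sum_add_distrib, ← sum_mul, hsum]; simp
      _ ≤ _ := by gcongr; exact Real.cosh_le_exp_half_sq _
  have hpow : ∑ t ∈ Fintype.piFinset (fun _ : Fin k => A), Real.exp (ε * ∑ i, Y (t i)) ≤
      (#A * Real.exp (ε ^ 2 / 2)) ^ k := by
    simp only [mul_sum, Real.exp_sum]
    rw [← prod_univ_sum (fun _ : Fin k => A) (fun _ x => Real.exp (ε * Y x))]
    simp only [prod_const, card_univ, Fintype.card_fin]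
    exact pow_le_pow_left₀ (sum_nonneg fun _ _ => (Real.exp_pos _).le) hexp k
  have hmarkov : (#{t ∈ Fintype.piFinset (fun _ : Fin k => A) | ε * k < ∑ i, Y (t i)} : ℝ) *
      Real.exp (ε * (ε * k)) ≤
      ∑ t ∈ Fintype.piFinset (fun _ : Fin k => A), Real.exp (ε * ∑ i, Y (t i)) := by
    rw [← nsmul_eq_mul, ← sum_const]
    refine (sum_le_sum fun t ht => ?_).trans
      (sum_le_sum_of_subset_of_nonneg (filter_subset _ _) fun _ _ _ => (Real.exp_pos _).le)
    have := (mem_filter.1 ht).2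
    gcongr
  have h := hmarkov.trans hpow
  rw [← le_div_iff₀ (Real.exp_pos _)] at h
  refine h.trans_eq ?_
  rw [mul_pow, ← Real.exp_nat_mul, mul_div_assoc, ← Real.exp_sub]
  congr 2
  ring

variable {Q : Type*} [AddCommGroup Q] [DecidableEq Q]

/-- The proportion of `a ∈ A` for which `x + a` lies in `S`. -/
noncomputable def density (A S : Finset Q) (x : Q) : ℝ :=
  (∑ a ∈ A, if x + a ∈ S then (1 : ℝ) else 0) / #A

lemma density_nonneg (A S : Finset Q) (x : Q) : 0 ≤ density A S x :=
  div_nonneg (sum_nonneg fun _ _ => by split_ifs <;> norm_num) (Nat.cast_nonneg _)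

lemma density_le_one (A S : Finset Q) (x : Q) : density A S x ≤ 1 := by
  refine div_le_one_of_le₀ ?_ (Nat.cast_nonneg _)
  calc _ ≤ ∑ a ∈ A, (1 : ℝ) := sum_le_sum fun _ _ => by split_ifs <;> norm_num
    _ = #A := by simp

/-- `x` is a point where sampling along the tuple `t` misestimates the density by more than `ε`. -/
def Misestimated (A S : Finset Q) (ε : ℝ) {k : ℕ} (t : Fin k → Q) (x : Q) : Prop :=
  ε * k < |∑ i, ((if x + t i ∈ S then (1 : ℝ) else 0) - density A S x)|

open scoped Classical in
lemma card_misestimated_le {A : Finset Q} (hA : A.Nonempty) (S : Finset Q) (k : ℕ)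
    {ε : ℝ} (hε : 0 ≤ ε) (x : Q) :
    (#{t ∈ Fintype.piFinset (fun _ : Fin k => A) | Misestimated A S ε t x} : ℝ) ≤
      2 * (#A ^ k * Real.exp (-(ε ^ 2 * k / 2))) := by
  set Y : Q → ℝ := fun a => (if x + a ∈ S then (1 : ℝ) else 0) - density A S x with hYdef
  have hY : ∀ a ∈ A, |Y a| ≤ 1 := by
    intro a _
    have h0 := density_nonneg A S x
    have h1 := density_le_one A S x
    rw [abs_le, hYdef]
    dsimp only
    split_ifs <;> constructor <;> linarith
  have hsum : ∑ a ∈ A, Y a = 0 := by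
    have : (#A : ℝ) ≠ 0 := by exact_mod_cast hA.card_pos.ne'
    simp only [hYdef, sum_sub_distrib, sum_const, nsmul_eq_mul, density]
    field_simp
    simp
  have h1 := card_filter_lt_sum_le A Y hY hsum k hε
  have h2 := card_filter_lt_sum_le A (fun a => - Y a) (by simpa using hY) (by simpa using hsum) k hε
  have hle : #{t ∈ Fintype.piFinset (fun _ : Fin k => A) | Misestimated A S ε t x} ≤
      #{t ∈ Fintype.piFinset (fun _ : Fin k => A) | ε * k < ∑ i, Y (t i)} +
      #{t ∈ Fintype.piFinset (fun _ : Fin k => A) | ε * k < ∑ i, - Y (t i)} := by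
    refine le_trans (card_le_card ?_) (card_union_le _ _)
    intro t ht
    simp only [mem_union, mem_filter] at ht ⊢
    rcases lt_abs.1 ht.2 with h | h
    · exact Or.inl ⟨ht.1, h⟩
    · exact Or.inr ⟨ht.1, by rwa [sum_neg_distrib]⟩
  have : (#{t ∈ Fintype.piFinset (fun _ : Fin k => A) | Misestimated A S ε t x} : ℝ) ≤
      #{t ∈ Fintype.piFinset (fun _ : Fin k => A) | ε * k < ∑ i, Y (t i)} +
      #{t ∈ Fintype.piFinset (fun _ : Fin k => A) | ε * k < ∑ i, - Y (t i)} := by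
    exact_mod_cast hle
  linarith

lemma density_add_self {A : Finset Q} (hA : A.Nonempty) {x : Q} (hx : x ∈ A) :
    density A (A + A) x = 1 := by
  have : (#A : ℝ) ≠ 0 := by exact_mod_cast hA.card_pos.ne'
  rw [density, sum_congr rfl fun a ha => if_pos (add_mem_add hx ha)]
  simp [this]

lemma landingCount_zero {A : Finset Q} (hA : A.Nonempty) (S T : Finset Q) (ι : Type*) [Fintype ι]
    [DecidableEq ι] : landingCount A S T ι 0 =
      ∑ t ∈ Fintype.piFinset (fun _ : ι => T), ∑ a ∈ A, #A * density A S (a + ∑ i, t i) := by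
  have : (#A : ℝ) ≠ 0 := by exact_mod_cast hA.card_pos.ne'
  refine sum_congr rfl fun t _ => sum_congr rfl fun a _ => ?_
  rw [density, mul_div_cancel₀ _ this]
  simp only [add_zero, add_right_comm]

variable [Fintype Q]

open scoped Classical in
/-- Most tuples from `A` estimate the density well at most points. -/
lemma card_pow_le_two_mul_card_good {A : Finset Q} (hA : A.Nonempty) (S : Finset Q) (k : ℕ)
    {ε δ : ℝ} (hε : 0 ≤ ε) (hδ : 0 < δ)
    (hk : Fintype.card Q * (4 * Real.exp (-(ε ^ 2 * k / 2))) ≤ δ * #A) :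
    (#A : ℝ) ^ k ≤ 2 * #{t ∈ Fintype.piFinset (fun _ : Fin k => A) |
      (#{x | Misestimated A S ε t x} : ℝ) ≤ δ * #A} := by
  set P := Fintype.piFinset (fun _ : Fin k => A) with hP
  have hA0 : (0 : ℝ) < #A := by exact_mod_cast hA.card_pos
  have hPcard : (#P : ℝ) = #A ^ k := by simp [hP]
  have hdouble : ∑ t ∈ P, (#{x | Misestimated A S ε t x} : ℝ) =
      ∑ x : Q, (#{t ∈ P | Misestimated A S ε t x} : ℝ) := by
    exact_mod_cast sum_card_bipartiteAbove_eq_sum_card_bipartiteBelow (s := P)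
      (t := (univ : Finset Q)) (fun t x => Misestimated A S ε t x)
  have hupper : ∑ t ∈ P, (#{x | Misestimated A S ε t x} : ℝ) ≤ δ * #A * #A ^ k / 2 := by
    rw [hdouble]
    calc _ ≤ ∑ x : Q, 2 * (#A ^ k * Real.exp (-(ε ^ 2 * k / 2))) :=
          sum_le_sum fun x _ => card_misestimated_le hA S k hε x
      _ = (Fintype.card Q * (4 * Real.exp (-(ε ^ 2 * k / 2)))) * #A ^ k / 2 := by
          simp; ring
      _ ≤ _ := by gcongr
  have hlower : (#{t ∈ P | ¬ (#{x | Misestimated A S ε t x} : ℝ) ≤ δ * #A} : ℝ) * (δ * #A) ≤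
      ∑ t ∈ P, (#{x | Misestimated A S ε t x} : ℝ) := by
    rw [← nsmul_eq_mul, ← sum_const]
    refine (sum_le_sum fun t ht => ?_).trans
      (sum_le_sum_of_subset_of_nonneg (filter_subset _ _) fun _ _ _ => Nat.cast_nonneg _)
    exact (not_le.1 (mem_filter.1 ht).2).le
  have hsplit : (#{t ∈ P | (#{x | Misestimated A S ε t x} : ℝ) ≤ δ * #A} : ℝ) +
      #{t ∈ P | ¬ (#{x | Misestimated A S ε t x} : ℝ) ≤ δ * #A} = #A ^ k := by
    rw [← hPcard]
    exact_mod_cast card_filter_add_card_filter_not _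
  have hbad : (#{t ∈ P | ¬ (#{x | Misestimated A S ε t x} : ℝ) ≤ δ * #A} : ℝ) ≤ #A ^ k / 2 := by
    refine le_of_mul_le_mul_right ((hlower.trans hupper).trans_eq ?_) (mul_pos hδ hA0)
    ring
  linarith

/-- The **Croot–Sisask lemma**: the density has many almost-periods. -/
lemma exists_almost_periods (h2 : ∀ x : Q, x + x = 0) {A : Finset Q} (hA : A.Nonempty)
    {K : ℝ} (hK : (#(A + A) : ℝ) ≤ K * #A) (S : Finset Q) {k : ℕ} (hk0 : 0 < k)
    {ε δ : ℝ} (hε : 0 ≤ ε) (hδ : 0 < δ)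
    (hk : Fintype.card Q * (4 * Real.exp (-(ε ^ 2 * k / 2))) ≤ δ * #A) :
    ∃ T : Finset Q, (#A : ℝ) ≤ 2 * K ^ k * #T ∧ ∀ s ∈ T, ∀ t ∈ T,
      (#{x | 2 * ε < |density A S (x + (s + t)) - density A S x|} : ℝ) ≤ 2 * (δ * #A) := by
  classical
  have hA0 : (0 : ℝ) < #A := by exact_mod_cast hA.card_pos
  set L := {t ∈ Fintype.piFinset (fun _ : Fin k => A) |
      (#{x | Misestimated A S ε t x} : ℝ) ≤ δ * #A} with hL
  have hLcard : (#A : ℝ) ^ k ≤ 2 * #L := card_pow_le_two_mul_card_good hA S k hε hδ hk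
  have hmaps : ∀ p ∈ L ×ˢ A, (fun i => p.1 i + p.2) ∈
      Fintype.piFinset (fun _ : Fin k => A + A) := by
    intro p hp
    rw [mem_product] at hp
    rw [Fintype.mem_piFinset]
    exact fun i => add_mem_add (Fintype.mem_piFinset.1 (mem_filter.1 hp.1).1 i) hp.2
  have hne : (Fintype.piFinset (fun _ : Fin k => A + A)).Nonempty := by
    rw [Fintype.piFinset_nonempty]
    exact fun _ => hA.add hA
  have hAA : (0 : ℝ) < #(A + A) := by exact_mod_cast (hA.add hA).card_pos
  obtain ⟨z, -, hz⟩ := exists_le_card_fiber_of_nsmul_le_card_of_maps_to (M := ℝ) hmaps hne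
    (b := #L * #A / (#(A + A)) ^ k) (by
      rw [nsmul_eq_mul, card_product]
      simp
      rw [mul_div_cancel₀]
      positivity)
  refine ⟨A.filter fun a => (fun i => z i + a) ∈ L, ?_, ?_⟩
  · have hle : #{p ∈ L ×ˢ A | (fun i => p.1 i + p.2) = z} ≤
        #(A.filter fun a => (fun i => z i + a) ∈ L) := by
      refine card_le_card_of_injOn Prod.snd ?_ ?_
      · rintro ⟨l, a⟩ hp
        simp only [coe_filter, mem_product, Set.mem_ofPred_eq] at hp ⊢
        refine ⟨hp.1.2, ?_⟩
        rw [← hp.2]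
        simpa [add_assoc, h2] using hp.1.1
      · rintro ⟨l, a⟩ hp ⟨l', a'⟩ hp' h
        simp only [coe_filter, mem_product, Set.mem_ofPred_eq] at hp hp' h
        subst h
        have := hp.2.trans hp'.2.symm
        simp only [Prod.mk.injEq, and_true]
        funext i
        simpa using congrFun this i
    have hle' : (#L * #A / (#(A + A)) ^ k : ℝ) ≤ #(A.filter fun a => (fun i => z i + a) ∈ L) :=
      hz.trans (by exact_mod_cast hle)
    rw [div_le_iff₀ (by positivity)] at hle'
    have hpow : (#(A + A) : ℝ) ^ k ≤ K ^ k * #A ^ k := by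
      rw [← mul_pow]; gcongr
    have h3 : (#A : ℝ) ^ k * #A ≤
        (2 * K ^ k * #(A.filter fun a => (fun i => z i + a) ∈ L)) * #A ^ k := by
      calc _ ≤ 2 * (#L * #A : ℝ) := by nlinarith
        _ ≤ 2 * (#(A.filter fun a => (fun i => z i + a) ∈ L) * (K ^ k * #A ^ k)) := by
          refine mul_le_mul_of_nonneg_left (hle'.trans ?_) zero_le_two
          gcongr
        _ = _ := by ring
    refine le_of_mul_le_mul_left (h3.trans_eq (mul_comm _ _)) (by positivity)
  · intro s hs t ht
    have hbad : ∀ a, (fun i => z i + a) ∈ L → ∀ y,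
        (#{x | Misestimated A S ε (fun i => z i + a) (x + y)} : ℝ) ≤ δ * #A := by
      intro a ha y
      refine le_trans ?_ (mem_filter.1 ha).2
      exact_mod_cast card_le_card_of_injOn (fun x => x + y) (by intro x; simp)
        (add_left_injective y).injOn
    have hbs := hbad s (mem_filter.1 hs).2 (s + t)
    have hbt := hbad t (mem_filter.1 ht).2 0
    have hsub : #{x | 2 * ε < |density A S (x + (s + t)) - density A S x|} ≤
        #{x | Misestimated A S ε (fun i => z i + s) (x + (s + t))} +
        #{x | Misestimated A S ε (fun i => z i + t) (x + 0)} := by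
      refine le_trans (card_le_card ?_) (card_union_le _ _)
      intro x hx
      simp only [mem_union, mem_filter, mem_univ, true_and] at hx ⊢
      by_contra! hcon
      obtain ⟨h1, h3⟩ := hcon
      simp only [Misestimated, not_lt, sum_sub_distrib, sum_const, card_univ, Fintype.card_fin,
        nsmul_eq_mul, add_zero] at h1 h3
      have hshift : ∀ i, x + (s + t) + (z i + s) = x + (z i + t) := by
        intro i
        calc _ = x + (z i + t) + (s + s) := by abel
          _ = _ := by rw [h2, add_zero]
      simp only [hshift] at h1
      have hk' : (0 : ℝ) < k := by exact_mod_cast hk0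
      rw [abs_le] at h1 h3
      have : |density A S (x + (s + t)) - density A S x| * k ≤ 2 * ε * k := by
        rw [← abs_of_pos hk', ← abs_mul, abs_of_pos hk', abs_le]
        constructor <;> linarith [h1.1, h1.2, h3.1, h3.2]
      exact absurd (le_of_mul_le_mul_right this hk') (not_le.2 hx)
    have hsub' : (#{x | 2 * ε < |density A S (x + (s + t)) - density A S x|} : ℝ) ≤
        #{x | Misestimated A S ε (fun i => z i + s) (x + (s + t))} +
        #{x | Misestimated A S ε (fun i => z i + t) (x + 0)} := by
      exact_mod_cast hsub
    linarith

lemma card_filter_lt_abs_sub_sum_le {ι : Type*} (s : Finset ι) (f : Q → ℝ) (u : ι → Q)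
    {c η : ℝ} (h : ∀ i ∈ s, (#{x | c < |f (x + u i) - f x|} : ℝ) ≤ η) :
    (#{x | c * #s < |f (x + ∑ i ∈ s, u i) - f x|} : ℝ) ≤ η * #s := by
  classical
  induction s using Finset.induction_on with
  | empty => simp
  | insert a s ha ih =>
    have ih := ih fun i hi => h i (mem_insert_of_mem hi)
    have h1 := h a (mem_insert_self a s)
    have hsub : #{x | c * #(insert a s) < |f (x + ∑ i ∈ insert a s, u i) - f x|} ≤
        #{x | c < |f (x + u a) - f x|} +
          #{x | c * #s < |f (x + ∑ i ∈ s, u i) - f x|} := by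
      have hshift : #{x | c < |f (x + ∑ i ∈ s, u i + u a) - f (x + ∑ i ∈ s, u i)|} ≤
          #{x | c < |f (x + u a) - f x|} :=
        card_le_card_of_injOn (fun x => x + ∑ i ∈ s, u i) (by intro x; simp)
          (add_left_injective _).injOn
      refine le_trans ?_ (Nat.add_le_add_right hshift _)
      refine le_trans (card_le_card ?_) (card_union_le _ _)
      intro x hx
      simp only [mem_union, mem_filter, mem_univ, true_and] at hx ⊢
      by_contra! hcon
      rw [card_insert_of_notMem ha, sum_insert ha, add_comm (u a), ← add_assoc] at hx
      push_cast at hx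
      have := abs_sub_le (f (x + ∑ i ∈ s, u i + u a)) (f (x + ∑ i ∈ s, u i)) (f x)
      linarith [hcon.1, hcon.2]
    have hsub' : (#{x | c * #(insert a s) < |f (x + ∑ i ∈ insert a s, u i) - f x|} : ℝ) ≤
        #{x | c < |f (x + u a) - f x|} +
          #{x | c * #s < |f (x + ∑ i ∈ s, u i) - f x|} := by exact_mod_cast hsub
    rw [card_insert_of_notMem ha] at hsub' ⊢
    push_cast at hsub' ⊢
    linarith

/-- If sums of two elements of `T` are almost-periods, then nearly all sums land in `A + A`. -/
lemma le_landingCount_zero {A : Finset Q} (hA : A.Nonempty) (T : Finset Q) {ℓ : ℕ} (hℓ : 0 < ℓ)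
    (hT : ∀ s ∈ T, ∀ t ∈ T,
      (#{x | 2 * (1 / (16 * ℓ) : ℝ) <
        |density A (A + A) (x + (s + t)) - density A (A + A) x|} : ℝ) ≤
        2 * ((1 / (16 * ℓ)) * #A)) :
    3 / 4 * (#T : ℝ) ^ (2 * ℓ) * #A ^ 2 ≤ landingCount A (A + A) T (Fin ℓ ⊕ Fin ℓ) 0 := by
  have hℓ' : (0 : ℝ) < ℓ := by exact_mod_cast hℓ
  rw [landingCount_zero hA]
  have hcard : (#(Fintype.piFinset (fun _ : Fin ℓ ⊕ Fin ℓ => T)) : ℝ) = #T ^ (2 * ℓ) := by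
    simp [two_mul]
  have key : ∀ t ∈ Fintype.piFinset (fun _ : Fin ℓ ⊕ Fin ℓ => T),
      3 / 4 * (#A : ℝ) ^ 2 ≤ ∑ a ∈ A, #A * density A (A + A) (a + ∑ i, t i) := by
    intro t ht
    rw [Fintype.mem_piFinset] at ht
    have hbad := card_filter_lt_abs_sub_sum_le univ (density A (A + A))
      (fun i : Fin ℓ => t (Sum.inl i) + t (Sum.inr i)) fun i _ => hT _ (ht _) _ (ht _)
    rw [sum_add_distrib, ← Fintype.sum_sum_type] at hbad
    simp only [card_univ, Fintype.card_fin] at hbad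
    have e1 : 2 * (1 / (16 * ℓ) : ℝ) * ℓ = 1 / 8 := by field_simp; norm_num
    have e2 : 2 * ((1 / (16 * ℓ) : ℝ) * #A) * ℓ = #A / 8 := by field_simp; norm_num
    rw [e1, e2] at hbad
    have hgood : (7 / 8 : ℝ) * #A ≤
        #{a ∈ A | (7 / 8 : ℝ) ≤ density A (A + A) (a + ∑ i, t i)} := by
      have hsplit : (#{a ∈ A | (7 / 8 : ℝ) ≤ density A (A + A) (a + ∑ i, t i)} : ℝ) +
          #{a ∈ A | ¬ (7 / 8 : ℝ) ≤ density A (A + A) (a + ∑ i, t i)} = #A := by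
        exact_mod_cast card_filter_add_card_filter_not _
      have hle : (#{a ∈ A | ¬ (7 / 8 : ℝ) ≤ density A (A + A) (a + ∑ i, t i)} : ℝ) ≤
          #{x | (1 / 8 : ℝ) < |density A (A + A) (x + ∑ i, t i) - density A (A + A) x|} := by
        norm_cast
        refine card_le_card fun a ha => ?_
        simp only [mem_filter, mem_univ, true_and, not_le] at ha ⊢
        rw [density_add_self hA ha.1, lt_abs]
        right
        linarith [ha.2]
      linarith
    rw [← mul_sum]
    have hsum : (7 / 8 : ℝ) * #{a ∈ A | (7 / 8 : ℝ) ≤ density A (A + A) (a + ∑ i, t i)} ≤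
        ∑ a ∈ A, density A (A + A) (a + ∑ i, t i) := by
      rw [mul_comm, ← nsmul_eq_mul, ← sum_const]
      refine (sum_le_sum fun a ha => (mem_filter.1 ha).2).trans
        (sum_le_sum_of_subset_of_nonneg (filter_subset _ _) fun _ _ _ => density_nonneg _ _ _)
    have : (3 / 4 : ℝ) * #A ≤ ∑ a ∈ A, density A (A + A) (a + ∑ i, t i) := by
      have : (0 : ℝ) ≤ #A := Nat.cast_nonneg _
      linarith
    calc _ = #A * (3 / 4 * (#A : ℝ)) := by ring
      _ ≤ _ := by gcongr
  calc _ = ∑ t ∈ Fintype.piFinset (fun _ : Fin ℓ ⊕ Fin ℓ => T), 3 / 4 * (#A : ℝ) ^ 2 := by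
        rw [sum_const, nsmul_eq_mul, hcard]; ring
    _ ≤ _ := sum_le_sum key

/-- If more than half of a translate of `V` lies in `S`, then `V ⊆ S + S`. -/
lemma subset_add_of_card_lt (h2 : ∀ x : Q, x + x = 0) (V : AddSubgroup Q) (S : Finset Q) (y : Q)
    [DecidablePred (· ∈ V)]
    (h : #{v | v ∈ V} < 2 * #{v | v ∈ V ∧ y + v ∈ S}) : (V : Set Q) ⊆ (S + S : Finset Q) := by
  intro w hw
  have hshift : #{v | v ∈ V ∧ y + (v + w) ∈ S} = #{v | v ∈ V ∧ y + v ∈ S} := by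
    refine card_bij (fun v _ => v + w) ?_ ?_ ?_
    · intro v hv
      simp only [mem_filter, mem_univ, true_and] at hv ⊢
      exact ⟨V.add_mem hv.1 hw, hv.2⟩
    · intro a _ b _ hab
      exact add_right_cancel hab
    · intro b hb
      simp only [mem_filter, mem_univ, true_and] at hb ⊢
      have : b + w + w = b := by rw [add_assoc, h2, add_zero]
      exact ⟨b + w, ⟨V.add_mem hb.1 hw, by rw [this]; exact hb.2⟩, this⟩
  have hinter : (filter (fun v => v ∈ V ∧ y + (v + w) ∈ S) univ ∩
      filter (fun v => v ∈ V ∧ y + v ∈ S) univ).Nonempty := by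
    rw [← card_pos]
    have hu := card_union_add_card_inter (filter (fun v => v ∈ V ∧ y + (v + w) ∈ S) univ)
      (filter (fun v => v ∈ V ∧ y + v ∈ S) univ)
    have hle : #(filter (fun v => v ∈ V ∧ y + (v + w) ∈ S) univ ∪
        filter (fun v => v ∈ V ∧ y + v ∈ S) univ) ≤ #{v | v ∈ V} := by
      refine card_le_card fun x hx => ?_
      simp only [mem_union, mem_filter, mem_univ, true_and] at hx ⊢
      tauto
    omega
  obtain ⟨v, hv⟩ := hinter
  simp only [mem_inter, mem_filter, mem_univ, true_and] at hv
  have : w = (y + (v + w)) + (y + v) := by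
    calc w = w + (y + y) + (v + v) := by rw [h2, h2, add_zero, add_zero]
      _ = _ := by abel
  rw [this]
  exact_mod_cast add_mem_add hv.1.2 hv.2.2

/-- A **Bogolyubov–Ruzsa lemma** for dense sets of small doubling in exponent two. -/
lemma exists_subgroup_subset (h2 : ∀ x : Q, x + x = 0) {A : Finset Q} (hA : A.Nonempty)
    {K : ℝ} (hK : (#(A + A) : ℝ) ≤ K * #A) {k ℓ : ℕ} (hk : 0 < k) (hℓ : 0 < ℓ)
    (hKℓ : 8 * K < 4 ^ ℓ)
    (hkℓ : Fintype.card Q * (4 * Real.exp (-((1 / (16 * ℓ) : ℝ) ^ 2 * k / 2))) ≤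
      1 / (16 * ℓ) * #A) :
    ∃ (V : AddSubgroup Q) (d : ℕ), (V : Set Q) ⊆ (A + A + (A + A) : Finset Q) ∧
      Fintype.card Q ≤ Nat.card V * 2 ^ d ∧
      Real.exp (d / 8) * #A ≤ 2 * K ^ k * Fintype.card Q := by
  classical
  have hA0 : (0 : ℝ) < #A := by exact_mod_cast hA.card_pos
  have hAA : (0 : ℝ) < #(A + A) := by exact_mod_cast (hA.add hA).card_pos
  have hK0 : 0 < K := pos_of_mul_pos_left (hAA.trans_le hK) hA0.le
  obtain ⟨T, hTcard, hT⟩ := exists_almost_periods h2 hA hK (A + A) hk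
    (by positivity : (0 : ℝ) ≤ 1 / (16 * ℓ)) (by positivity : (0 : ℝ) < 1 / (16 * ℓ)) hkℓ
  have hT0 : (0 : ℝ) < #T := by
    by_contra! h
    have : 2 * K ^ k * (#T : ℝ) ≤ 0 := mul_nonpos_of_nonneg_of_nonpos (by positivity) h
    linarith
  have hTne : T.Nonempty := card_pos.1 (by exact_mod_cast hT0)
  obtain ⟨D, hD, hDT, hDmax⟩ := exists_maximal_independent h2
    (fun ψ => (#T : ℝ) / 2 ≤ |hat T ψ|)
  have hchang := exp_card_mul_card_le h2 hTne hD hDT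
  set V := annihilator h2 D with hV
  refine ⟨V, #D, ?_, card_le_card_annihilator h2 D, ?_⟩
  swap
  · calc _ ≤ Real.exp (#D / 8) * (2 * K ^ k * #T) := by gcongr
      _ = 2 * K ^ k * (Real.exp (#D / 8) * #T) := by ring
      _ ≤ _ := by gcongr
  have hzero := le_landingCount_zero hA T hℓ hT
  have hcount : ∀ v ∈ V, 1 / 2 * (#T : ℝ) ^ (2 * ℓ) * #A ^ 2 <
      landingCount A (A + A) T (Fin ℓ ⊕ Fin ℓ) v := by
    intro v hv
    have h := abs_landingCount_sub_le h2 A (A + A) T (Fin ℓ ⊕ Fin ℓ) v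
      fun ψ hψ => hDmax ψ hψ v hv
    have herr : 2 * (#T / 2 : ℝ) ^ Fintype.card (Fin ℓ ⊕ Fin ℓ) * #(A + A) * #A <
        1 / 4 * (#T : ℝ) ^ (2 * ℓ) * #A ^ 2 := by
      have hc : Fintype.card (Fin ℓ ⊕ Fin ℓ) = 2 * ℓ := by simp [two_mul]
      have h4 : (2 : ℝ) ^ (2 * ℓ) = 4 ^ ℓ := by rw [pow_mul]; norm_num
      rw [hc, div_pow, h4]
      calc _ ≤ 2 * ((#T : ℝ) ^ (2 * ℓ) / 4 ^ ℓ) * (K * #A) * #A := by gcongr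
        _ = (8 * K) / 4 ^ ℓ * (1 / 4 * (#T : ℝ) ^ (2 * ℓ) * #A ^ 2) := by ring
        _ < 1 * (1 / 4 * (#T : ℝ) ^ (2 * ℓ) * #A ^ 2) := by
          gcongr
          rwa [div_lt_one (by positivity)]
        _ = _ := one_mul _
    linarith [(abs_le.1 h).1]
  have hex : ∃ y, #{v | v ∈ V} < 2 * #{v | v ∈ V ∧ y + v ∈ A + A} := by
    by_contra! hcon
    have hlow : (#{v | v ∈ V} : ℝ) * (1 / 2 * (#T : ℝ) ^ (2 * ℓ) * #A ^ 2) <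
        ∑ v ∈ univ.filter (· ∈ V), landingCount A (A + A) T (Fin ℓ ⊕ Fin ℓ) v := by
      rw [← nsmul_eq_mul, ← sum_const]
      exact sum_lt_sum_of_nonempty ⟨0, by simp [V.zero_mem]⟩
        fun v hv => hcount v (mem_filter.1 hv).2
    have hup : ∑ v ∈ univ.filter (· ∈ V), landingCount A (A + A) T (Fin ℓ ⊕ Fin ℓ) v ≤
        ∑ t ∈ Fintype.piFinset (fun _ : Fin ℓ ⊕ Fin ℓ => T), ∑ a ∈ A, ∑ b ∈ A,
          (#{v | v ∈ V} : ℝ) / 2 := by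
      simp only [landingCount]
      rw [sum_comm]
      refine sum_le_sum fun t _ => ?_
      rw [sum_comm]
      refine sum_le_sum fun a _ => ?_
      rw [sum_comm]
      refine sum_le_sum fun b _ => ?_
      rw [sum_boole, filter_filter]
      have : (2 * #{v | v ∈ V ∧ a + b + ∑ i, t i + v ∈ A + A} : ℝ) ≤ #{v | v ∈ V} := by
        exact_mod_cast hcon (a + b + ∑ i, t i)
      linarith
    have heq : ∑ t ∈ Fintype.piFinset (fun _ : Fin ℓ ⊕ Fin ℓ => T), ∑ a ∈ A, ∑ b ∈ A,
          (#{v | v ∈ V} : ℝ) / 2 = #{v | v ∈ V} * (1 / 2 * (#T : ℝ) ^ (2 * ℓ) * #A ^ 2) := by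
      simp [two_mul]
      ring
    linarith
  obtain ⟨y, hy⟩ := hex
  exact subset_add_of_card_lt h2 V (A + A) y hy

end Sampling

section Quantitative

lemma two_thirds_lt_log {K : ℝ} (hK : 2 ≤ K) : 2 / 3 < Real.log K :=
  (by linarith [Real.log_two_gt_d9] : (2 / 3 : ℝ) < Real.log 2).trans_le
    (Real.log_le_log two_pos hK)

/-- A subset of small doubling and density at least `K⁻¹²` has a large subgroup in its fourfold
sumset. -/
lemma exists_subgroup_subset_of_dense {Q : Type*} [AddCommGroup Q] [Fintype Q] [DecidableEq Q]
    (h2 : ∀ x : Q, x + x = 0) {A : Finset Q} (hA : A.Nonempty) {K : ℝ} (hK2 : 2 ≤ K)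
    (hK : (#(A + A) : ℝ) ≤ K * #A) (hQ : (Fintype.card Q : ℝ) ≤ K ^ 12 * #A) :
    ∃ (V : AddSubgroup Q) (d : ℕ), (V : Set Q) ⊆ (A + A + (A + A) : Finset Q) ∧
      Fintype.card Q ≤ Nat.card V * 2 ^ d ∧ (d : ℝ) ≤ 12000000 * Real.log K ^ 4 := by
  have hA0 : (0 : ℝ) < #A := by exact_mod_cast hA.card_pos
  have hK0 : 0 < K := by linarith
  have hL := two_thirds_lt_log hK2
  set L := Real.log K with hLdef
  have hexpL : Real.exp L = K := Real.exp_log hK0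
  set ℓ : ℕ := ⌈L⌉₊ + 2 with hℓdef
  have hℓ1 : L + 2 ≤ ℓ := by
    rw [hℓdef]; push_cast; linarith [Nat.le_ceil L]
  have hℓ2 : (ℓ : ℝ) ≤ 6 * L := by
    rw [hℓdef]; push_cast; linarith [Nat.ceil_lt_add_one (by linarith : 0 ≤ L)]
  have hℓ0 : (0 : ℝ) < ℓ := by linarith
  have hKℓ : 8 * K < 4 ^ ℓ := by
    have h1 : K ≤ 4 ^ ⌈L⌉₊ := by
      calc K = Real.exp L := hexpL.symm
        _ ≤ Real.exp (⌈L⌉₊ * 1) := by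
          gcongr
          linarith [Nat.le_ceil L]
        _ = Real.exp 1 ^ ⌈L⌉₊ := Real.exp_nat_mul _ _
        _ ≤ _ := by
          gcongr
          linarith [Real.exp_one_lt_d9]
    rw [hℓdef, pow_add]
    linarith
  have hkℓ : Fintype.card Q *
      (4 * Real.exp (-((1 / (16 * ℓ) : ℝ) ^ 2 * (6656 * ℓ ^ 3 : ℕ) / 2))) ≤
      1 / (16 * ℓ) * #A := by
    have he : (1 / (16 * ℓ) : ℝ) ^ 2 * (6656 * ℓ ^ 3 : ℕ) / 2 = 13 * ℓ := by
      push_cast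
      field_simp
      norm_num
    have hbig : K ^ 12 * (64 * ℓ) ≤ Real.exp (13 * ℓ) := by
      have h12 : K ^ 12 * 64 ≤ Real.exp (12 * ℓ) := by
        calc K ^ 12 * 64 ≤ Real.exp L ^ 12 * Real.exp 1 ^ 24 := by
              rw [hexpL]
              gcongr
              calc (64 : ℝ) ≤ 2 ^ 24 := by norm_num
                _ ≤ _ := by
                  gcongr
                  linarith [Real.exp_one_gt_d9]
          _ = Real.exp (12 * (L + 2)) := by
              rw [← Real.exp_nat_mul, ← Real.exp_nat_mul, ← Real.exp_add]
              congr 1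
              push_cast
              ring
          _ ≤ _ := by gcongr
      calc K ^ 12 * (64 * ℓ) = K ^ 12 * 64 * ℓ := by ring
        _ ≤ Real.exp (12 * ℓ) * Real.exp ℓ := by
          gcongr
          linarith [Real.add_one_le_exp (ℓ : ℝ)]
        _ = _ := by rw [← Real.exp_add]; congr 1; ring
    rw [he, Real.exp_neg]
    calc _ ≤ K ^ 12 * #A * (4 * (Real.exp (13 * ℓ))⁻¹) := by gcongr
      _ = K ^ 12 * (64 * ℓ) * (Real.exp (13 * ℓ))⁻¹ * (1 / (16 * ℓ) * #A) := by
        field_simp; norm_num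
      _ ≤ 1 * (1 / (16 * ℓ) * #A) := by
        gcongr
        rw [← div_eq_mul_inv]
        exact div_le_one_of_le₀ hbig (Real.exp_pos _).le
      _ = _ := one_mul _
  obtain ⟨V, d, hV, hcard, hd⟩ := exists_subgroup_subset h2 hA hK (by positivity)
    (by omega) hKℓ hkℓ
  refine ⟨V, d, hV, hcard, ?_⟩
  have hd' : Real.exp (d / 8) ≤ Real.exp (L * (6656 * ℓ ^ 3 + 13)) := by
    refine le_of_mul_le_mul_right ?_ hA0
    calc _ ≤ 2 * K ^ (6656 * ℓ ^ 3) * (K ^ 12 * #A) := hd.trans (by gcongr)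
      _ ≤ K * K ^ (6656 * ℓ ^ 3) * (K ^ 12 * #A) := by gcongr
      _ = K ^ (6656 * ℓ ^ 3 + 13) * #A := by ring
      _ = _ := by
        rw [← hexpL, ← Real.exp_nat_mul]
        push_cast
        ring_nf
  rw [Real.exp_le_exp] at hd'
  have hℓ3 : (ℓ : ℝ) ^ 3 ≤ 216 * L ^ 3 := by
    calc (ℓ : ℝ) ^ 3 ≤ (6 * L) ^ 3 := by gcongr
      _ = _ := by ring
  have hL3 : 8 / 27 ≤ L ^ 3 := by
    calc (8 / 27 : ℝ) = (2 / 3) ^ 3 := by norm_num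
      _ ≤ _ := by gcongr
  have : L * (6656 * ℓ ^ 3 + 13) ≤ L * (1500000 * L ^ 3) := by
    gcongr
    linarith
  calc (d : ℝ) ≤ 8 * (L * (1500000 * L ^ 3)) := by linarith
    _ = _ := by ring

end Quantitative

section Model

variable {G : Type*} [AddCommGroup G]

lemma mem_or_add_mem_of_mem_sup_zmultiples (h2 : ∀ x : G, x + x = 0) {N : AddSubgroup G}
    {x y : G} (hx : x ∈ N ⊔ AddSubgroup.zmultiples y) : x ∈ N ∨ x + y ∈ N := by
  obtain ⟨n, hn, z, hz, rfl⟩ := AddSubgroup.mem_sup.1 hx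
  obtain ⟨m, rfl⟩ := AddSubgroup.mem_zmultiples_iff.1 hz
  have h2y : (2 : ℤ) • y = 0 := by rw [two_zsmul, h2]
  rcases Int.even_or_odd' m with ⟨r, rfl | rfl⟩
  · left
    simpa [mul_comm, mul_zsmul, h2y] using hn
  · right
    simpa [mul_comm, mul_zsmul, h2y, add_zsmul, add_assoc, h2] using hn

/-- A subgroup maximal subject to meeting `B` trivially: every element is congruent to an element
of `B` modulo this subgroup. -/
lemma exists_subgroup_complement (h2 : ∀ x : G, x + x = 0) (B : Set G) (hB : 0 ∈ B) :
    ∃ N : AddSubgroup G, (∀ x ∈ N, x ∈ B → x = 0) ∧ ∀ y, ∃ b ∈ B, y + b ∈ N := by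
  obtain ⟨N, hN⟩ := zorn_le₀ {N : AddSubgroup G | ∀ x ∈ N, x ∈ B → x = 0} (by
    intro c hc hchain
    rcases c.eq_empty_or_nonempty with rfl | hne
    · exact ⟨⊥, by simp +contextual, by simp⟩
    · refine ⟨sSup c, ?_, fun _ => le_sSup⟩
      intro x hx hxB
      rw [AddSubgroup.mem_sSup_of_directedOn hne hchain.directedOn] at hx
      obtain ⟨N, hN, hxN⟩ := hx
      exact hc hN x hxN hxB)
  refine ⟨N, hN.prop, fun y => ?_⟩
  by_contra! hy
  have hyN : y ∉ N := by simpa using hy 0 hB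
  have hle : N ⊔ AddSubgroup.zmultiples y ≤ N := by
    refine hN.le_of_ge ?_ le_sup_left
    intro x hx hxB
    rcases mem_or_add_mem_of_mem_sup_zmultiples h2 hx with h | h
    · exact hN.prop x h hxB
    · exact absurd (by rwa [add_comm]) (hy x hxB)
  exact hyN (hle (AddSubgroup.mem_sup_right (AddSubgroup.mem_zmultiples y)))

/-- In exponent two, a finite subgroup contains subgroups of every size up to a factor of two. -/
lemma exists_subgroup_card_le (h2 : ∀ x : G, x + x = 0) (H : AddSubgroup G) [Finite H] {n : ℕ}
    (hn : 0 < n) :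
    ∃ H' ≤ H, Nat.card H' ≤ n ∧ (Nat.card H ≤ Nat.card H' ∨ n ≤ 2 * Nat.card H') := by
  have hwf : {H' : AddSubgroup G | H' ≤ H ∧ Nat.card H' ≤ n}.Finite := by
    refine Set.Finite.of_finite_image (f := fun H' : AddSubgroup G => (H' : Set G)) ?_
      SetLike.coe_injective.injOn
    refine ((Set.toFinite (H : Set G)).finite_subsets).subset ?_
    rintro _ ⟨H', h, rfl⟩
    exact h.1
  obtain ⟨H', ⟨hle, hcard⟩, hmax⟩ := hwf.exists_maximalFor id _
    ⟨⊥, bot_le, by simpa using Nat.succ_le_of_lt hn⟩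
  refine ⟨H', hle, hcard, ?_⟩
  by_cases heq : H ≤ H'
  · left
    rw [le_antisymm heq hle]
  · right
    obtain ⟨y, hy, hyH'⟩ := SetLike.not_le_iff_exists.1 heq
    have hsup : H' ⊔ AddSubgroup.zmultiples y ≤ H :=
      sup_le hle ((AddSubgroup.zmultiples_le_of_mem hy))
    have hlt : n < Nat.card (H' ⊔ AddSubgroup.zmultiples y : AddSubgroup G) := by
      by_contra! h
      exact hyH' (hmax ⟨hsup, h⟩ le_sup_left
        (AddSubgroup.mem_sup_right (AddSubgroup.mem_zmultiples y)))
    have hcover : ((H' ⊔ AddSubgroup.zmultiples y : AddSubgroup G) : Set G) ⊆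
        (H' : Set G) ∪ (fun x => x + y) '' (H' : Set G) := by
      intro x hx
      rcases mem_or_add_mem_of_mem_sup_zmultiples h2 hx with h | h
      · exact Or.inl h
      · exact Or.inr ⟨x + y, h, by simp [add_assoc, h2]⟩
    have hH'fin : (H' : Set G).Finite := (Set.toFinite (H : Set G)).subset hle
    have h1 := Set.ncard_le_ncard hcover (hH'fin.union (hH'fin.image _))
    have h3 := h1.trans (Set.ncard_union_le _ _)
    have h4 := Set.ncard_image_le (f := fun x => x + y) hH'fin
    rw [← Nat.card_coe_set_eq] at h3
    rw [← Nat.card_coe_set_eq (H' : Set G)] at h3 h4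
    simp only [SetLike.coe_sort_coe] at h3 h4
    omega

variable [DecidableEq G]

lemma card_nsmul_le {A : Finset G} (hA : A.Nonempty) {K : ℝ} (hK : (#(A + A) : ℝ) ≤ K * #A)
    (n : ℕ) : (#(n • A) : ℝ) ≤ K ^ n * #A := by
  have hA0 : (0 : ℝ) < #A := by exact_mod_cast hA.card_pos
  have h := pluennecke_ruzsa_inequality_nsmul_add hA A n
  have h' : (#(n • A) : ℝ) ≤ (#(A + A) / #A : ℝ) ^ n * #A := by
    have := NNRat.cast_mono (K := ℝ) h
    push_cast at this
    exact this
  refine h'.trans ?_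
  gcongr
  rwa [div_le_iff₀ hA0]

/-- The **Bogolyubov–Ruzsa lemma** with quasi-polynomial bounds, in exponent two. -/
lemma exists_subgroup_subset_four_nsmul (h2 : ∀ x : G, x + x = 0) {A : Finset G}
    (hA : A.Nonempty) {K : ℝ} (hK2 : 2 ≤ K) (hK : (#(A + A) : ℝ) ≤ K * #A) :
    ∃ (H : AddSubgroup G) (d : ℕ), (H : Set G) ⊆ (4 • A : Finset G) ∧
      #A ≤ Nat.card H * 2 ^ d ∧ (d : ℝ) ≤ 12000000 * Real.log K ^ 4 := by
  classical
  have hzero2 : (0 : G) ∈ 2 • A := by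
    obtain ⟨a, ha⟩ := hA
    rw [two_nsmul, ← h2 a]
    exact add_mem_add ha ha
  have hzero : ∀ n : ℕ, (0 : G) ∈ (2 * n) • A := by
    intro n
    induction n with
    | zero => simp
    | succ n ih =>
      rw [mul_add, add_nsmul, ← add_zero (0 : G)]
      exact add_mem_add ih hzero2
  have hmono : 2 • A ⊆ 12 • A := by
    intro x hx
    rw [show 12 = 2 + 2 * 5 from rfl, add_nsmul, ← add_zero x]
    exact add_mem_add hx (hzero 5)
  obtain ⟨N, hN, hcover⟩ := exists_subgroup_complement h2 ((12 • A : Finset G) : Set G)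
    (hzero 6)
  set φ : G →+ G ⧸ N := QuotientAddGroup.mk' N with hφ
  have hφ_eq : ∀ x y, φ x = φ y ↔ x + y ∈ N := by
    intro x y
    rw [hφ, QuotientAddGroup.mk'_apply, QuotientAddGroup.mk'_apply, QuotientAddGroup.eq,
      neg_eq_of_add_eq_zero_left (h2 x)]
  have hsurj : ∀ q : G ⧸ N, q ∈ (12 • A).image φ := by
    intro q
    obtain ⟨y, rfl⟩ := QuotientAddGroup.mk'_surjective N q
    obtain ⟨b, hb, hyb⟩ := hcover y
    exact mem_image.2 ⟨b, hb, ((hφ_eq y b).2 hyb).symm⟩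
  have : Fintype (G ⧸ N) := ⟨(12 • A).image φ, hsurj⟩
  have h2Q : ∀ q : G ⧸ N, q + q = 0 := by
    intro q
    obtain ⟨y, rfl⟩ := QuotientAddGroup.mk'_surjective N q
    rw [← map_add, h2, map_zero]
  have hinj : Set.InjOn φ A := by
    intro a ha b hb hab
    rw [hφ_eq] at hab
    rw [← add_eq_zero_iff_eq_of_exponent_two h2]
    refine hN _ hab (hmono ?_)
    rw [two_nsmul]
    exact add_mem_add ha hb
  have hAcard : #(A.image φ) = #A := card_image_of_injOn hinj
  have hAA : (#(A.image φ + A.image φ) : ℝ) ≤ K * #(A.image φ) := by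
    rw [hAcard, ← image_add]
    exact le_trans (by exact_mod_cast card_image_le) hK
  have hQ : (Fintype.card (G ⧸ N) : ℝ) ≤ K ^ 12 * #(A.image φ) := by
    rw [hAcard]
    refine le_trans ?_ (card_nsmul_le hA hK 12)
    have : Fintype.card (G ⧸ N) ≤ #(12 • A) := by
      refine le_trans ?_ (card_image_le (s := 12 • A) (f := φ))
      exact card_le_card fun q _ => hsurj q
    exact_mod_cast this
  obtain ⟨V, d, hV, hVcard, hd⟩ := exists_subgroup_subset_of_dense h2Q (hA.image φ) hK2 hAA hQ
  have hV4 : ∀ v ∈ V, ∃ x ∈ 4 • A, φ x = v := by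
    intro v hv
    have := hV hv
    rw [← image_add, ← image_add, ← two_nsmul A, ← two_nsmul (2 • A), ← mul_nsmul] at this
    exact mem_image.1 (mem_coe.1 this)
  have hfour : ∀ {x y z : G}, x ∈ 4 • A → y ∈ 4 • A → z ∈ 4 • A → x + y + z ∈ 12 • A := by
    intro x y z hx hy hz
    rw [show 12 = 4 + 4 + 4 from rfl, add_nsmul, add_nsmul]
    exact add_mem_add (add_mem_add hx hy) hz
  let H : AddSubgroup G :=
    { carrier := {x | x ∈ 4 • A ∧ φ x ∈ V}
      zero_mem' := ⟨hzero 2, by simp [V.zero_mem]⟩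
      add_mem' := by
        rintro x y ⟨hx, hxV⟩ ⟨hy, hyV⟩
        have hxy : φ (x + y) ∈ V := by rw [map_add]; exact V.add_mem hxV hyV
        obtain ⟨z, hz, hzxy⟩ := hV4 _ hxy
        have h0 := hN _ ((hφ_eq (x + y) z).1 hzxy.symm) (hfour hx hy hz)
        rw [add_eq_zero_iff_eq_of_exponent_two h2] at h0
        exact ⟨by rwa [h0], hxy⟩
      neg_mem' := by
        rintro x hx
        rwa [neg_eq_of_add_eq_zero_left (h2 x)] }
  have hH4 : (H : Set G) ⊆ (4 • A : Finset G) := fun x hx => hx.1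
  refine ⟨H, d, hH4, ?_, hd⟩
  have : Finite H := (finite_toSet (4 • A)).subset hH4
  have hVH : Nat.card V ≤ Nat.card H := by
    refine Nat.card_le_card_of_surjective (fun x : H => (⟨φ x, x.2.2⟩ : V)) ?_
    rintro ⟨v, hv⟩
    obtain ⟨x, hx, rfl⟩ := hV4 v hv
    exact ⟨⟨x, hx, hv⟩, rfl⟩
  calc #A = #(A.image φ) := hAcard.symm
    _ ≤ Fintype.card (G ⧸ N) := card_le_univ _
    _ ≤ Nat.card V * 2 ^ d := hVcard
    _ ≤ _ := by gcongr

end Model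

section Covering

variable {G : Type*} [AddCommGroup G] [DecidableEq G]

/-- A set of small doubling is covered by quasi-polynomially many translates of a subgroup that is
no larger than the set. -/
lemma exists_subgroup_cover (h2 : ∀ x : G, x + x = 0) {A : Finset G} (hA : A.Nonempty) {K : ℝ}
    (hK2 : 2 ≤ K) (hK : (#(A + A) : ℝ) ≤ K * #A) :
    ∃ H : AddSubgroup G, (H : Set G).Finite ∧ (H : Set G).ncard ≤ #A ∧
      ∃ X : Finset G, (#X : ℝ) ≤ Real.exp (13000000 * Real.log K ^ 4) ∧
        (A : Set G) ⊆ (X : Set G) + (H : Set G) := by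
  have hK0 : 0 < K := by linarith
  obtain ⟨H₀, d, hH₀A, hH₀card, hd⟩ := exists_subgroup_subset_four_nsmul h2 hA hK2 hK
  have hH₀fin : Finite H₀ := (finite_toSet (4 • A)).subset hH₀A
  obtain ⟨H, hH, hHA, hHcard⟩ := exists_subgroup_card_le h2 H₀ hA.card_pos
  have hHfin : (H : Set G).Finite := (Set.toFinite (H₀ : Set G)).subset hH
  have hncard : (H : Set G).ncard = Nat.card H := (Nat.card_coe_set_eq _).symm
  refine ⟨H, hHfin, by rwa [hncard], ?_⟩
  set B := hHfin.toFinset with hB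
  have hBcard : #B = Nat.card H := by rw [← hncard, Set.ncard_eq_toFinset_card _ hHfin]
  have hABcard : #A ≤ #B * 2 ^ (d + 1) := by
    rw [hBcard, pow_succ]
    have h1 : 1 ≤ 2 ^ d := Nat.one_le_two_pow
    rcases hHcard with h | h <;> nlinarith
  have hB0 : B.Nonempty := ⟨0, by simp [hB, H.zero_mem]⟩
  have hsub : A + B ⊆ 5 • A := by
    rw [show 5 = 1 + 4 from rfl, add_nsmul, one_nsmul]
    refine add_subset_add_left fun x hx => ?_
    exact hH₀A (hH (by simpa [hB] using hx))
  have hAB : (#(A + B) : ℝ) ≤ K ^ 5 * 2 ^ (d + 1) * #B := by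
    calc (#(A + B) : ℝ) ≤ #(5 • A) := by exact_mod_cast card_le_card hsub
      _ ≤ K ^ 5 * #A := card_nsmul_le hA hK 5
      _ ≤ K ^ 5 * (#B * 2 ^ (d + 1)) := by
        gcongr
        exact_mod_cast hABcard
      _ = _ := by ring
  obtain ⟨X, -, hX, hcover⟩ := ruzsa_covering_add hB0 hAB
  refine ⟨X, hX.trans ?_, ?_⟩
  · have hL := two_thirds_lt_log hK2
    set L := Real.log K with hLdef
    have h2e : (2 : ℝ) ^ (d + 1) ≤ Real.exp (d + 1) := by
      calc (2 : ℝ) ^ (d + 1) ≤ Real.exp 1 ^ (d + 1) := by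
            gcongr
            linarith [Real.exp_one_gt_d9]
        _ = _ := by rw [← Real.exp_nat_mul]; push_cast; ring_nf
    have hL3 : 8 / 27 ≤ L ^ 3 := by
      calc (8 / 27 : ℝ) = (2 / 3) ^ 3 := by norm_num
        _ ≤ _ := by gcongr
    calc K ^ 5 * 2 ^ (d + 1) ≤ Real.exp L ^ 5 * Real.exp (d + 1) := by
          rw [hLdef, Real.exp_log hK0]
          gcongr
      _ = Real.exp (5 * L + (d + 1)) := by
          rw [← Real.exp_nat_mul, ← Real.exp_add]
          norm_num
      _ ≤ _ := by
          rw [Real.exp_le_exp]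
          nlinarith
  · intro a ha
    have h := hcover ha
    obtain ⟨x, hx, y, hy, rfl⟩ := mem_add.1 h
    obtain ⟨b, hb, c, hc, rfl⟩ := mem_sub.1 hy
    refine Set.add_mem_add hx ?_
    exact H.sub_mem (by simpa [hB] using hb) (by simpa [hB] using hc)

end Covering

end QuasiPolynomialFreimanRuzsa

/-- Sanders's quasi-polynomial Freiman–Ruzsa theorem: in an elementary abelian 2-group, a
set with doubling at most `K ≥ 2` is covered by `exp(C (log K)^{4+ε})` translates of a
subgroup of size at most `|A|`. -/
theorem sanders_quasipolynomial_fr (ε : ℝ) (hε : 0 < ε) :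
    ∃ C : ℝ, 1 ≤ C ∧
      ∀ (G : Type*) [AddCommGroup G] [DecidableEq G],
        (∀ x : G, x + x = 0) →
        ∀ K : ℝ, 2 ≤ K →
          ∀ A : Finset G, A.Nonempty → ((A + A).card : ℝ) ≤ K * A.card →
            ∃ H : AddSubgroup G, (H : Set G).Finite ∧
              ((H : Set G).ncard : ℝ) ≤ A.card ∧
              ∃ X : Finset G,
                (X.card : ℝ) ≤ Real.exp (C * Real.log K ^ (4 + ε)) ∧
                (↑A : Set G) ⊆ (↑X : Set G) + (H : Set G) := by
  have hlog0 : 0 < Real.log 2 := Real.log_pos one_lt_two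
  have hpow0 : 0 < Real.log 2 ^ ε := Real.rpow_pos_of_pos hlog0 ε
  have hpow1 : Real.log 2 ^ ε ≤ 1 :=
    Real.rpow_le_one hlog0.le (by linarith [Real.log_two_lt_d9]) hε.le
  refine ⟨13000000 / Real.log 2 ^ ε, ?_, ?_⟩
  · rw [le_div_iff₀ hpow0]
    linarith
  intro G _ _ h2 K hK2 A hA hK
  obtain ⟨H, hHfin, hHA, X, hX, hcover⟩ :=
    QuasiPolynomialFreimanRuzsa.exists_subgroup_cover h2 hA hK2 hK
  refine ⟨H, hHfin, by exact_mod_cast hHA, X, hX.trans ?_, hcover⟩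
  have hL : Real.log 2 ≤ Real.log K := Real.log_le_log two_pos hK2
  rw [Real.exp_le_exp, div_mul_eq_mul_div, le_div_iff₀ hpow0,
    Real.rpow_add (hlog0.trans_le hL), mul_assoc]
  norm_cast
  gcongr
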